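/- Let X be Borel distributed with parameter μ ∈ (0,1). Then the fourth cumulant of X, which equals E[(X − E[X])⁴] − 3 (Var[X])², is given by κ_X^{(4)} = μ(1 + 8μ + 6μ²)/(1−μ)⁷. -/

import Mathlib

open Filter Topology Finset

/-- The series `∑ (n + 1)ᵏ (n + 1)ⁿ / (n + 1)! xⁿ`; for `k = 0` this is the rooted tree function
divided by `x`. -/
noncomputable def treeSeries (k : ℕ) (x : ℝ) : ℝ :=
  ∑' n : ℕ, ((n : ℝ) + 1) ^ k * (((n : ℝ) + 1) ^ n / (n + 1).factorial) * x ^ n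

theorem treeCoeff_le (n : ℕ) :
    ((n : ℝ) + 1) ^ n / (n + 1).factorial ≤ Real.exp 1 * Real.exp 1 ^ n := by
  have h := Real.pow_div_factorial_le_exp (x := (n : ℝ) + 1) (by positivity) (n + 1)
  have e : Real.exp ((n : ℝ) + 1) = Real.exp 1 * Real.exp 1 ^ n := by
    rw [← Real.exp_nat_mul, ← Real.exp_add]; ring_nf
  rw [← e]
  refine le_trans ?_ h
  gcongr
  · linarith [(Nat.cast_nonneg n : (0 : ℝ) ≤ n)]
  · omega

theorem summable_succ_pow_mul_geometric (k : ℕ) {q : ℝ} (hq0 : 0 ≤ q) (hq1 : q < 1) :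
    Summable fun n : ℕ => ((n : ℝ) + 1) ^ k * q ^ n := by
  rcases hq0.eq_or_lt with rfl | hq
  · refine summable_of_ne_finset_zero (s := {0}) fun n hn => ?_
    have : n ≠ 0 := by simpa using hn
    simp [this]
  · have h := summable_pow_mul_geometric_of_norm_lt_one (R := ℝ) k (r := q)
      (by rwa [Real.norm_of_nonneg hq0])
    have h' := ((summable_nat_add_iff 1).2 h).mul_right q⁻¹
    refine h'.congr fun n => ?_
    rw [pow_succ]
    push_cast
    field_simp

theorem summable_treeSeries_abs (k : ℕ) {x : ℝ} (hx : |x| * Real.exp 1 < 1) :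
    Summable fun n : ℕ =>
      ((n : ℝ) + 1) ^ k * (((n : ℝ) + 1) ^ n / (n + 1).factorial) * |x| ^ n := by
  have h := (summable_succ_pow_mul_geometric k (q := |x| * Real.exp 1)
    (by positivity) hx).mul_left (Real.exp 1)
  refine Summable.of_nonneg_of_le (fun n => by positivity) (fun n => ?_) h
  calc _ ≤ ((n : ℝ) + 1) ^ k * (Real.exp 1 * Real.exp 1 ^ n) * |x| ^ n := by
        gcongr; exact treeCoeff_le n
    _ = _ := by rw [mul_pow]; ring

theorem summable_treeSeries (k : ℕ) {x : ℝ} (hx : |x| * Real.exp 1 < 1) :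
    Summable fun n : ℕ =>
      ((n : ℝ) + 1) ^ k * (((n : ℝ) + 1) ^ n / (n + 1).factorial) * x ^ n := by
  refine Summable.of_norm ((summable_treeSeries_abs k hx).congr fun n => ?_)
  rw [norm_mul, norm_pow, Real.norm_eq_abs x, Real.norm_of_nonneg (by positivity)]

theorem exists_abs_lt_mul_exp_one_lt {x : ℝ} (hx : |x| * Real.exp 1 < 1) :
    ∃ r, |x| < r ∧ r * Real.exp 1 < 1 := by
  have he := Real.exp_pos 1
  obtain ⟨r, h1, h2⟩ := exists_between ((lt_div_iff₀ he).2 hx)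
  exact ⟨r, h1, (lt_div_iff₀ he).1 h2⟩

theorem hasDerivAt_mul_treeSeries (k : ℕ) {x : ℝ} (hx : |x| * Real.exp 1 < 1) :
    HasDerivAt (fun y => y * treeSeries k y) (treeSeries (k + 1) x) x := by
  obtain ⟨r, hxr, hr⟩ := exists_abs_lt_mul_exp_one_lt hx
  have hr0 : 0 < r := (abs_nonneg x).trans_lt hxr
  have hu := summable_treeSeries_abs (k + 1) (x := r) (by rwa [abs_of_pos hr0])
  have key := hasDerivAt_tsum_of_isPreconnected
    (g := fun (n : ℕ) (y : ℝ) =>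
      ((n : ℝ) + 1) ^ k * (((n : ℝ) + 1) ^ n / (n + 1).factorial) * y ^ (n + 1))
    (g' := fun (n : ℕ) (y : ℝ) =>
      ((n : ℝ) + 1) ^ (k + 1) * (((n : ℝ) + 1) ^ n / (n + 1).factorial) * y ^ n)
    (y₀ := 0) (y := x) hu
    (Metric.isOpen_ball (x := (0 : ℝ)) (ε := r)) (convex_ball _ _).isPreconnected
    (fun n y _ => by
      have h := (hasDerivAt_pow (n + 1) y).const_mul
        (((n : ℝ) + 1) ^ k * (((n : ℝ) + 1) ^ n / (n + 1).factorial))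
      refine h.congr_deriv ?_
      rw [Nat.add_sub_cancel]
      push_cast
      ring)
    (fun n y hy => by
      have hy' : |y| < r := by simpa using hy
      rw [norm_mul, norm_pow, Real.norm_eq_abs y, Real.norm_of_nonneg (by positivity),
        abs_of_pos hr0]
      gcongr)
    (by simpa using hr0) (by simp)
    (by simpa using hxr)
  refine key.congr_of_eventuallyEq (Eventually.of_forall fun y => ?_)
  simp only [treeSeries]
  rw [← tsum_mul_left]
  exact tsum_congr fun n => by ring

theorem analyticAt_treeSeries_zero {x : ℝ} (hx : |x| * Real.exp 1 < 1) :
    AnalyticAt ℝ (treeSeries 0) x := by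
  obtain ⟨r, hxr, hr⟩ := exists_abs_lt_mul_exp_one_lt hx
  have hr0 : 0 < r := (abs_nonneg x).trans_lt hxr
  lift r to NNReal using hr0.le
  set p := FormalMultilinearSeries.ofScalars ℝ
    (fun n : ℕ => ((n : ℝ) + 1) ^ n / ((n + 1).factorial : ℝ)) with hp
  have hrad : (r : ENNReal) ≤ p.radius := by
    refine p.le_radius_of_summable ?_
    refine (summable_treeSeries_abs 0 (x := (r : ℝ)) (by rwa [abs_of_pos hr0])).congr fun n => ?_
    rw [hp, FormalMultilinearSeries.ofScalars_norm, Real.norm_of_nonneg (by positivity),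
      abs_of_pos hr0]
    simp
  have hrpos : (0 : ENNReal) < (r : ENNReal) := by
    exact_mod_cast hr0
  have hball := p.hasFPowerSeriesOnBall (hrpos.trans_le hrad)
  have hsum : p.sum = treeSeries 0 := by
    funext y
    refine (FormalMultilinearSeries.ofScalars_sum_eq _ y).trans ?_
    simp [treeSeries]
  rw [← hsum]
  refine hball.analyticAt_of_mem ?_
  refine Metric.eball_subset_eball hrad ?_
  rw [Metric.mem_eball, edist_zero_right, ← ofReal_norm, Real.norm_eq_abs,
    ENNReal.ofReal_lt_coe_iff (abs_nonneg x)]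
  exact hxr

theorem sum_antidiagonal_tree_eq_zero (N : ℕ) (hN : N ≠ 0) :
    ∑ p ∈ antidiagonal N, ((p.1 : ℝ) + 1) ^ p.1 / (p.1 + 1).factorial *
      ((-((p.1 : ℝ) + 1)) ^ p.2 / p.2.factorial) = 0 := by
  have h := congrFun (fwdDiff_iter_pow_eq_zero_of_lt (R := ℝ) (Nat.lt_succ_self N)) 0
  rw [fwdDiff_iter_eq_sum_shift, sum_range_succ'] at h
  simp only [Pi.zero_apply, zero_smul, add_zero, zero_pow hN, smul_zero] at h
  rw [Finset.Nat.sum_antidiagonal_eq_sum_range_succ_mk]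
  have hf : ((N + 1).factorial : ℝ) ≠ 0 := by positivity
  refine (mul_eq_zero.1 (?_ : ((N + 1).factorial : ℝ) * _ = 0)).resolve_left hf
  rw [mul_sum]
  refine (sum_congr rfl fun n hn => ?_).trans h
  have hn' : n ≤ N := Nat.lt_succ_iff.1 (mem_range.1 hn)
  have e2 : N.succ - (n + 1) = N - n := by omega
  have hc' : ((N + 1).choose (n + 1) : ℝ) * (N - n).factorial * (n + 1).factorial
      = (N + 1).factorial := by
    have := Nat.choose_mul_factorial_mul_factorial (show n + 1 ≤ N + 1 by omega)
    rw [show N + 1 - (n + 1) = N - n by omega] at this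
    rw [← this]; push_cast; ring
  have hp : ((n : ℝ) + 1) ^ N = ((n : ℝ) + 1) ^ n * ((n : ℝ) + 1) ^ (N - n) := by
    rw [← pow_add]; congr 1; omega
  rw [e2, ← hc', neg_pow]
  simp only [zsmul_eq_mul, nsmul_eq_mul, Nat.succ_eq_add_one, zero_add]
  push_cast
  rw [mul_one, hp]
  field_simp

theorem treeSeries_zero_of_small {μ : ℝ} (hμ : |μ| * Real.exp |μ| * Real.exp 1 < 1) :
    Real.exp (-μ) * treeSeries 0 (μ * Real.exp (-μ)) = 1 := by
  set f : ℕ × ℕ → ℝ := fun p => (((p.1 : ℝ) + 1) ^ p.1 / (p.1 + 1).factorial * μ ^ p.1) *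
    ((-((p.1 : ℝ) + 1) * μ) ^ p.2 / p.2.factorial) with hf
  have hexp : ∀ t : ℝ, HasSum (fun j : ℕ => t ^ j / j.factorial) (Real.exp t) := fun t => by
    rw [Real.exp_eq_exp_ℝ]; exact NormedSpace.expSeries_div_hasSum_exp t
  have hnorm : ∀ n j : ℕ, ‖f (n, j)‖ = (((n : ℝ) + 1) ^ n / (n + 1).factorial * |μ| ^ n) *
      ((((n : ℝ) + 1) * |μ|) ^ j / j.factorial) := fun n j => by
    have : |(n : ℝ) + 1| = n + 1 := abs_of_nonneg (by positivity)
    simp only [hf, Real.norm_eq_abs, abs_mul, abs_div, abs_pow, abs_neg, this, Nat.abs_cast]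
  have hsum : Summable f := by
    refine Summable.of_norm ((summable_prod_of_nonneg fun _ => norm_nonneg _).2 ⟨fun n => ?_, ?_⟩)
    · simp only [hnorm]
      exact (hexp _).summable.mul_left _
    · simp only [hnorm, tsum_mul_left, (hexp _).tsum_eq]
      have h := (summable_treeSeries_abs 0 (x := |μ| * Real.exp |μ|)
        (by rwa [abs_of_nonneg (by positivity)])).mul_left (Real.exp |μ|)
      refine h.congr fun n => ?_
      rw [abs_of_nonneg (by positivity : 0 ≤ |μ| * Real.exp |μ|), mul_pow, ← Real.exp_nat_mul, add_mul, Real.exp_add]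
      ring_nf
  have h1 : ∑' p, f p = Real.exp (-μ) * treeSeries 0 (μ * Real.exp (-μ)) := by
    rw [hsum.tsum_prod, treeSeries, ← tsum_mul_left]
    refine tsum_congr fun n => ?_
    simp only [hf]
    rw [tsum_mul_left, (hexp _).tsum_eq, mul_pow, ← Real.exp_nat_mul,
      show -((n : ℝ) + 1) * μ = n * -μ + -μ by ring, Real.exp_add]
    ring
  have hsum' : Summable fun c => f (Finset.HasAntidiagonal.sigmaAntidiagonalEquivProd c) :=
    Finset.HasAntidiagonal.sigmaAntidiagonalEquivProd.summable_iff.2 hsum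
  rw [← h1, ← Finset.HasAntidiagonal.sigmaAntidiagonalEquivProd.tsum_eq f,
    hsum'.tsum_sigma' (fun n => (hasSum_fintype _).summable),
    tsum_eq_single 0]
  · simp [hf]
  · intro N hN
    rw [tsum_fintype]
    have := Finset.sum_finset_coe f (antidiagonal N)
    refine this.trans ?_
    rw [← mul_zero (μ ^ N), ← sum_antidiagonal_tree_eq_zero N hN, mul_sum]
    refine sum_congr rfl fun p hp => ?_
    rw [← mem_antidiagonal.1 hp]
    simp only [hf]
    rw [mul_pow, pow_add]
    ring

theorem abs_mul_exp_neg_lt {μ : ℝ} (h0 : 0 ≤ μ) (h1 : μ < 1) :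
    |μ * Real.exp (-μ)| * Real.exp 1 < 1 := by
  rw [abs_of_nonneg (by positivity), mul_assoc, ← Real.exp_add]
  have h := Real.add_one_lt_exp (x := μ - 1) (by linarith)
  have h2 : Real.exp (μ - 1) * Real.exp (-μ + 1) = 1 := by
    rw [← Real.exp_add]; simp
  calc μ * Real.exp (-μ + 1) < Real.exp (μ - 1) * Real.exp (-μ + 1) := by
        gcongr; linarith
    _ = 1 := h2

/-- The `k`-th moment of the Borel distribution. -/
noncomputable def borelMoment (k : ℕ) (μ : ℝ) : ℝ :=
  Real.exp (-μ) * treeSeries k (μ * Real.exp (-μ))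

theorem borelMoment_zero {μ : ℝ} (h0 : 0 ≤ μ) (h1 : μ < 1) : borelMoment 0 μ = 1 := by
  have han : AnalyticOnNhd ℝ (borelMoment 0) (Set.Ico 0 1) := fun x hx => by
    have hT := analyticAt_treeSeries_zero (abs_mul_exp_neg_lt hx.1 hx.2)
    have he : AnalyticAt ℝ (fun y : ℝ => Real.exp (-y)) x := by fun_prop
    have hm : AnalyticAt ℝ (fun y : ℝ => y * Real.exp (-y)) x := by fun_prop
    exact he.mul (AnalyticAt.fun_comp (f := fun y : ℝ => y * Real.exp (-y)) hT hm)
  refine han.eqOn_of_preconnected_of_eventuallyEq (g := fun _ => 1) analyticOnNhd_const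
    isPreconnected_Ico (z₀ := 0) (by simp) ?_ ⟨h0, h1⟩
  have hc : Continuous fun y : ℝ => |y| * Real.exp |y| * Real.exp 1 := by fun_prop
  filter_upwards [hc.continuousAt.eventually_lt (x₀ := 0) (continuousAt_const (y := (1 : ℝ)))
    (by simp)] with y hy
  exact treeSeries_zero_of_small hy

theorem hasDerivAt_mul_borelMoment (k : ℕ) {μ : ℝ} (h0 : 0 ≤ μ) (h1 : μ < 1) :
    HasDerivAt (fun y => y * borelMoment k y) ((1 - μ) * borelMoment (k + 1) μ) μ := by
  have hx : HasDerivAt (fun y : ℝ => y * Real.exp (-y))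
      (1 * Real.exp (-μ) + μ * (Real.exp (-μ) * -1)) μ :=
    (hasDerivAt_id μ).mul (hasDerivAt_neg μ).exp
  have h := (hasDerivAt_mul_treeSeries k (abs_mul_exp_neg_lt h0 h1)).comp μ hx
  refine (h.congr_deriv ?_).congr_of_eventuallyEq (Eventually.of_forall fun y => ?_)
  · simp only [borelMoment]; ring
  · simp only [borelMoment, Function.comp_apply]; ring

/-- A closed form of one moment on `(0, 1)` determines the next by differentiation. -/
theorem borelMoment_succ_eq {k : ℕ} {g : ℝ → ℝ} {g' μ : ℝ} (h0 : 0 < μ) (h1 : μ < 1)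
    (hg : ∀ y, 0 < y → y < 1 → borelMoment k y = g y)
    (hd : HasDerivAt (fun y => y * g y) ((1 - μ) * g') μ) : borelMoment (k + 1) μ = g' := by
  have h := hasDerivAt_mul_borelMoment k h0.le h1
  have h2 := hd.congr_of_eventuallyEq (f₁ := fun y => y * borelMoment k y) (by
    filter_upwards [Ioo_mem_nhds h0 h1] with y hy
    rw [hg y hy.1 hy.2])
  exact mul_left_cancel₀ (by linarith) (h.unique h2)

theorem borelMoment_one {μ : ℝ} (h0 : 0 < μ) (h1 : μ < 1) :
    borelMoment 1 μ = 1 / (1 - μ) := by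
  have hne : 1 - μ ≠ 0 := by linarith
  refine borelMoment_succ_eq (g := fun _ => 1) h0 h1
    (fun y hy hy' => borelMoment_zero hy.le hy') ?_
  refine ((hasDerivAt_id μ).mul_const 1).congr_deriv ?_
  field_simp

theorem hasDerivAt_mul_div_one_sub_pow (p : ℝ → ℝ) (p' : ℝ) (m : ℕ) {μ : ℝ} (h1 : μ < 1)
    (hp : HasDerivAt p p' μ) :
    HasDerivAt (fun y => y * (p y / (1 - y) ^ (m + 1)))
      (((p μ + μ * p') * (1 - μ) + (m + 1) * μ * p μ) / (1 - μ) ^ (m + 2)) μ := by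
  have hne : 1 - μ ≠ 0 := by linarith
  have hs := ((hasDerivAt_id μ).const_sub 1).pow (m + 1)
  refine ((hasDerivAt_id μ).mul (hp.div hs (pow_ne_zero _ hne))).congr_deriv ?_
  simp only [id, Pi.pow_apply, Pi.div_apply]
  rw [Nat.add_sub_cancel]
  push_cast
  field_simp
  ring

theorem borelMoment_two {μ : ℝ} (h0 : 0 < μ) (h1 : μ < 1) :
    borelMoment 2 μ = 1 / (1 - μ) ^ 3 := by
  have hne : 1 - μ ≠ 0 := by linarith
  refine borelMoment_succ_eq (g := fun y => 1 / (1 - y) ^ (0 + 1)) h0 h1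
    (fun y hy hy' => by simpa using borelMoment_one hy hy') ?_
  refine (hasDerivAt_mul_div_one_sub_pow (fun _ => 1) 0 0 h1
    (hasDerivAt_const _ _)).congr_deriv ?_
  field_simp
  push_cast
  ring

theorem borelMoment_three {μ : ℝ} (h0 : 0 < μ) (h1 : μ < 1) :
    borelMoment 3 μ = (1 + 2 * μ) / (1 - μ) ^ 5 := by
  have hne : 1 - μ ≠ 0 := by linarith
  refine borelMoment_succ_eq (g := fun y => 1 / (1 - y) ^ (2 + 1)) h0 h1
    (fun y hy hy' => borelMoment_two hy hy') ?_
  refine (hasDerivAt_mul_div_one_sub_pow (fun _ => 1) 0 2 h1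
    (hasDerivAt_const _ _)).congr_deriv ?_
  field_simp
  push_cast
  ring

theorem borelMoment_four {μ : ℝ} (h0 : 0 < μ) (h1 : μ < 1) :
    borelMoment 4 μ = (1 + 8 * μ + 6 * μ ^ 2) / (1 - μ) ^ 7 := by
  have hne : 1 - μ ≠ 0 := by linarith
  refine borelMoment_succ_eq (g := fun y => (1 + 2 * y) / (1 - y) ^ (4 + 1)) h0 h1
    (fun y hy hy' => borelMoment_three hy hy') ?_
  refine (hasDerivAt_mul_div_one_sub_pow (fun y => 1 + 2 * y) 2 4 h1
    (by simpa using ((hasDerivAt_id μ).const_mul 2).const_add 1)).congr_deriv ?_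
  field_simp
  push_cast
  ring

theorem hasSum_borelMoment (k : ℕ) {μ : ℝ} (h0 : 0 ≤ μ) (h1 : μ < 1) :
    HasSum (fun n : ℕ => ((n : ℝ) + 1) ^ k *
      (Real.exp (-μ * (n + 1)) * (μ * (n + 1)) ^ n / (n + 1).factorial)) (borelMoment k μ) := by
  refine ((summable_treeSeries k (abs_mul_exp_neg_lt h0 h1)).hasSum.mul_left
    (Real.exp (-μ))).congr_fun fun n => ?_
  rw [mul_pow μ, mul_pow μ, ← Real.exp_nat_mul,
    show -μ * ((n : ℝ) + 1) = n * -μ + -μ by ring, Real.exp_add]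
  ring

/-- For a Borel distributed random variable `X` with parameter `μ ∈ (0,1)`, the fourth
cumulant, which equals `E[(X - E[X])⁴] - 3 (Var[X])²`, is
`κ_X^{(4)} = μ(1 + 8μ + 6μ²)/(1-μ)⁷`. -/
theorem borel_fourth_cumulant (μ : ℝ) (hμ0 : 0 < μ) (hμ1 : μ < 1)
    (m : ℝ)
    (hm : m = ∑' n : ℕ, ((n : ℝ) + 1) *
      (Real.exp (-μ * (n + 1)) * (μ * (n + 1)) ^ n / (n + 1).factorial)) :
    (∑' n : ℕ, ((n : ℝ) + 1 - m) ^ 4 *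
      (Real.exp (-μ * (n + 1)) * (μ * (n + 1)) ^ n / (n + 1).factorial))
    - 3 * (∑' n : ℕ, ((n : ℝ) + 1 - m) ^ 2 *
      (Real.exp (-μ * (n + 1)) * (μ * (n + 1)) ^ n / (n + 1).factorial)) ^ 2
      = μ * (1 + 8 * μ + 6 * μ ^ 2) / (1 - μ) ^ 7 := by
  have hne : 1 - μ ≠ 0 := by linarith
  have H := fun k => hasSum_borelMoment k hμ0.le hμ1
  have hm' : m = 1 / (1 - μ) := by
    rw [hm, ← borelMoment_one hμ0 hμ1, ← (H 1).tsum_eq]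
    simp only [pow_one]
  have S2 := (((H 2).add ((H 1).mul_left (-2 * m))).add ((H 0).mul_left (m ^ 2)))
  have S4 := (((((H 4).add ((H 3).mul_left (-4 * m))).add ((H 2).mul_left (6 * m ^ 2))).add
    ((H 1).mul_left (-4 * m ^ 3))).add ((H 0).mul_left (m ^ 4)))
  have E2 := (S2.congr_fun (g := fun n : ℕ => ((n : ℝ) + 1 - m) ^ 2 *
    (Real.exp (-μ * (n + 1)) * (μ * (n + 1)) ^ n / (n + 1).factorial)) fun n => by ring).tsum_eq
  have E4 := (S4.congr_fun (g := fun n : ℕ => ((n : ℝ) + 1 - m) ^ 4 *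
    (Real.exp (-μ * (n + 1)) * (μ * (n + 1)) ^ n / (n + 1).factorial)) fun n => by ring).tsum_eq
  rw [E2, E4, borelMoment_zero hμ0.le hμ1, borelMoment_one hμ0 hμ1, borelMoment_two hμ0 hμ1,
    borelMoment_three hμ0 hμ1, borelMoment_four hμ0 hμ1, hm']
  field_simp
  ring
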